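/- arXiv:math/0701888 — 2 statements merged into one kernel-verified Lean document; each statement's English description precedes it below -/
import Mathlib

section
/- The transformation built from α¹ produces the bridge covariance: for all s, t ∈ (0,T], ∫₀^T (α¹ 1_{[0,s)})(u) (α¹ 1_{[0,t)})(u) z(u)² du = A(min(s,t)) − A(s)A(t)/A(T), where (α¹f)(u) = f(u) − A(u)⁻¹ ∫₀^u f(v) z(v)² dv. (This expresses that B⁽¹⁾(M)_t = ∫₀^T (α¹1_{[0,t)})(s) dM_s is a bridge of the Gaussian martingale M with ⟨M⟩ = A, i.e. it has the covariance function of M conditioned on M_T = 0.) -/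
open MeasureTheory Set

open Filter in
/-- The reciprocal of an absolutely continuous function bounded below by a positive constant is
absolutely continuous. -/
theorem AbsolutelyContinuousOnInterval.inv_of_le {f : ℝ → ℝ} {a b c : ℝ}
    (hf : AbsolutelyContinuousOnInterval f a b) (hc : 0 < c) (hcf : ∀ x ∈ uIcc a b, c ≤ f x) :
    AbsolutelyContinuousOnInterval (fun x => (f x)⁻¹) a b := by
  have hlim := Tendsto.const_mul (c ^ 2)⁻¹ hf
  rw [mul_zero] at hlim
  refine squeeze_zero' (Eventually.of_forall fun E => Finset.sum_nonneg fun i _ => dist_nonneg)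
    ?_ hlim
  filter_upwards [mem_inf_of_right (mem_principal_self _)] with E hE
  rw [Finset.mul_sum]
  refine Finset.sum_le_sum fun i hi => ?_
  obtain ⟨h₁, h₂⟩ := hE.1 i hi
  have h₁ := hcf _ h₁
  have h₂ := hcf _ h₂
  have hp₁ := hc.trans_le h₁
  have hp₂ := hc.trans_le h₂
  rw [Real.dist_eq, Real.dist_eq, inv_sub_inv hp₁.ne' hp₂.ne', abs_div, abs_sub_comm,
    abs_of_pos (mul_pos hp₁ hp₂), div_eq_inv_mul]
  gcongr
  rw [sq]
  gcongr

/-- If the primitive `F` of `w` from `c` is bounded below by a positive constant on `[a, b]`, then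
`∫ₐᵇ w / F² = 1 / F(a) - 1 / F(b)`. -/
theorem intervalIntegral_div_sq_primitive {w : ℝ → ℝ} {a b c d m : ℝ}
    (hw : IntervalIntegrable w volume c d) (hab : uIcc a b ⊆ uIcc c d) (hm : 0 < m)
    (hF : ∀ x ∈ uIcc a b, m ≤ ∫ y in c..x, w y) :
    ∫ x in a..b, w x / (∫ y in c..x, w y) ^ 2
      = (∫ y in c..a, w y)⁻¹ - (∫ y in c..b, w y)⁻¹ := by
  have hac := ((hw.absolutelyContinuousOnInterval_intervalIntegral left_mem_uIcc).mono
    hab).inv_of_le hm hF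
  rw [← neg_sub, ← hac.integral_deriv_eq_sub, ← intervalIntegral.integral_neg]
  refine intervalIntegral.integral_congr_ae ?_
  filter_upwards [hw.ae_hasDerivAt_integral] with x hx hxab
  have hx' := uIoc_subset_uIcc hxab
  have hd := (hx (hab hx') c left_mem_uIcc).fun_inv (hm.trans_le (hF x hx')).ne'
  rw [hd.deriv]
  ring

theorem intervalIntegral_indicator_Ico_mul {w : ℝ → ℝ} {s u : ℝ} (hs : 0 ≤ s) (hu : 0 ≤ u) :
    ∫ v in (0:ℝ)..u, Set.indicator (Set.Ico 0 s) (fun _ => (1:ℝ)) v * w v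
      = ∫ v in (0:ℝ)..min u s, w v := by
  have h : (fun v => Set.indicator (Set.Ico 0 s) (fun _ => (1:ℝ)) v * w v)
      = Set.indicator (Set.Ico 0 s) w := by
    ext v
    by_cases hv : v ∈ Set.Ico 0 s <;> simp [hv]
  rw [h, intervalIntegral.integral_of_le hu, intervalIntegral.integral_of_le (le_min hu hs),
    setIntegral_indicator measurableSet_Ico]
  refine setIntegral_congr_set ?_
  have h' := (ae_eq_refl (μ := volume) (Ioc 0 u)).inter (Ico_ae_eq_Ioc (a := (0:ℝ)) (b := s))
  rwa [Ioc_inter_Ioc, sup_idem] at h'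

/-- The bridge covariance identity for ordered times and a general weight `w` in place of `z²`. -/
theorem bridge_covariance_of_le {T s t : ℝ} {w A : ℝ → ℝ}
    (hw : IntervalIntegrable w volume 0 T) (hA : ∀ t, A t = ∫ s in (0:ℝ)..t, w s)
    (hpos : ∀ u ∈ Ioc 0 T, 0 < A u) (hmono : MonotoneOn A (Ioc 0 T))
    (hs0 : 0 < s) (hst : s ≤ t) (htT : t ≤ T) :
    (∫ u in (0:ℝ)..T,
      (Set.indicator (Set.Ico 0 s) (fun _ => (1:ℝ)) u
        - (A u)⁻¹ * ∫ v in (0:ℝ)..u, Set.indicator (Set.Ico 0 s) (fun _ => (1:ℝ)) v * w v)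
      * (Set.indicator (Set.Ico 0 t) (fun _ => (1:ℝ)) u
        - (A u)⁻¹ * ∫ v in (0:ℝ)..u, Set.indicator (Set.Ico 0 t) (fun _ => (1:ℝ)) v * w v)
      * w u)
    = A s - A s * A t / A T := by
  have ht0 := hs0.trans_le hst
  have hT0 := ht0.trans_le htT
  have htmem : t ∈ Ioc 0 T := ⟨ht0, htT⟩
  rw [intervalIntegral.integral_of_le hT0.le]
  have hcongr : ∀ u ∈ Ioc 0 T,
      (Set.indicator (Set.Ico 0 s) (fun _ => (1:ℝ)) u
        - (A u)⁻¹ * ∫ v in (0:ℝ)..u, Set.indicator (Set.Ico 0 s) (fun _ => (1:ℝ)) v * w v)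
      * (Set.indicator (Set.Ico 0 t) (fun _ => (1:ℝ)) u
        - (A u)⁻¹ * ∫ v in (0:ℝ)..u, Set.indicator (Set.Ico 0 t) (fun _ => (1:ℝ)) v * w v)
      * w u = Set.indicator (Ici t) (fun u => A s * A t * (w u / A u ^ 2)) u := by
    intro u hu
    have hAu := (hpos u hu).ne'
    rw [intervalIntegral_indicator_Ico_mul hs0.le hu.1.le,
      intervalIntegral_indicator_Ico_mul ht0.le hu.1.le, ← hA, ← hA]
    rcases lt_or_ge u t with hut | hut
    · have hmem : u ∈ Ico 0 t := ⟨hu.1.le, hut⟩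
      rw [indicator_of_mem hmem, min_eq_left hut.le, inv_mul_cancel₀ hAu,
        indicator_of_notMem (notMem_Ici.2 hut)]
      ring
    · rw [indicator_of_notMem (fun h => h.2.not_ge (hst.trans hut)),
        indicator_of_notMem (fun h => h.2.not_ge hut), min_eq_right hut,
        min_eq_right (hst.trans hut), indicator_of_mem (mem_Ici.2 hut)]
      ring
  have hset : Ioc 0 T ∩ Ici t = Icc t T := by
    ext u
    simp only [mem_inter_iff, mem_Ioc, mem_Ici, mem_Icc]
    exact ⟨fun h => ⟨h.2, h.1.2⟩, fun h => ⟨⟨ht0.trans_le h.1, h.2⟩, h.1⟩⟩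
  have hsub : uIcc t T ⊆ uIcc 0 T := by
    rw [uIcc_of_le htT, uIcc_of_le hT0.le]
    exact Icc_subset_Icc_left ht0.le
  have hint : ∫ u in t..T, w u / A u ^ 2 = (A t)⁻¹ - (A T)⁻¹ := by
    simp only [hA]
    refine intervalIntegral_div_sq_primitive hw hsub (hpos t htmem) fun x hx => ?_
    rw [uIcc_of_le htT] at hx
    rw [← hA]
    exact hmono htmem ⟨ht0.trans_le hx.1, hx.2⟩ hx.1
  rw [setIntegral_congr_fun measurableSet_Ioc hcongr, setIntegral_indicator measurableSet_Ici,
    hset, integral_Icc_eq_integral_Ioc, ← intervalIntegral.integral_of_le htT,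
    intervalIntegral.integral_const_mul, hint]
  have := (hpos t htmem).ne'
  field_simp

/-- The transformation built from `α¹` produces the bridge covariance: for
`s, t ∈ (0,T]`,
`∫₀ᵀ (α¹ 1_{[0,s)})(u) (α¹ 1_{[0,t)})(u) z(u)² du = A(min(s,t)) − A(s)A(t)/A(T)`,
where `(α¹ f)(u) = f(u) − A(u)⁻¹ ∫₀ᵘ f(v) z(v)² dv`. -/
theorem alpha1_transformation_bridge_covariance
    (T : ℝ) (hT : 0 < T)
    (z : ℝ → ℝ) (hz : Measurable z)
    (hz2 : IntegrableOn (fun s => z s ^ 2) (Set.Ioc 0 T))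
    (hzne : ∀ᵐ s ∂(volume.restrict (Set.Ioc 0 T)), z s ≠ 0)
    (A : ℝ → ℝ) (hA : ∀ t, A t = ∫ s in (0:ℝ)..t, z s ^ 2)
    (s t : ℝ) (hs0 : 0 < s) (hsT : s ≤ T) (ht0 : 0 < t) (htT : t ≤ T) :
    (∫ u in (0:ℝ)..T,
      (Set.indicator (Set.Ico 0 s) (fun _ => (1:ℝ)) u
        - (A u)⁻¹ * ∫ v in (0:ℝ)..u, Set.indicator (Set.Ico 0 s) (fun _ => (1:ℝ)) v * z v ^ 2)
      * (Set.indicator (Set.Ico 0 t) (fun _ => (1:ℝ)) u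
        - (A u)⁻¹ * ∫ v in (0:ℝ)..u, Set.indicator (Set.Ico 0 t) (fun _ => (1:ℝ)) v * z v ^ 2)
      * z u ^ 2)
    = A (min s t) - A s * A t / A T := by
  have hw : IntervalIntegrable (fun s => z s ^ 2) volume 0 T :=
    (intervalIntegrable_iff_integrableOn_Ioc_of_le hT.le).2 hz2
  have hpos : ∀ u ∈ Ioc 0 T, 0 < A u := by
    intro u hu
    have hsub : Ioc 0 u ⊆ Ioc 0 T := Ioc_subset_Ioc_right hu.2
    rw [hA, intervalIntegral.integral_of_le hu.1.le,
      setIntegral_pos_iff_support_of_nonneg_ae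
        (Filter.Eventually.of_forall fun x => sq_nonneg (z x)) (hz2.mono_set hsub)]
    have hae : Function.support (fun s => z s ^ 2) =ᵐ[volume.restrict (Ioc 0 u)] Set.univ := by
      rw [Filter.eventuallyEq_univ]
      filter_upwards [ae_restrict_of_ae_restrict_of_subset hsub hzne] with x hx
      exact pow_ne_zero 2 hx
    rw [← Measure.restrict_apply' measurableSet_Ioc,
      measure_congr hae, Measure.restrict_apply_univ]
    simpa using hu.1
  have hmono : MonotoneOn A (Ioc 0 T) := by
    intro a ha b hb hab
    rw [hA, hA]
    refine intervalIntegral.integral_mono_interval le_rfl ha.1.le hab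
      (Filter.Eventually.of_forall fun x => sq_nonneg (z x)) ?_
    exact hw.mono_set (by
      rw [uIcc_of_le hb.1.le, uIcc_of_le hT.le]; exact Icc_subset_Icc_right hb.2)
  rcases le_total s t with hst | hts
  · rw [min_eq_left hst]
    exact bridge_covariance_of_le hw hA hpos hmono hs0 hst htT
  · rw [min_eq_right hts, mul_comm (A s), ← bridge_covariance_of_le hw hA hpos hmono ht0 hts hsT]
    refine intervalIntegral.integral_congr fun u _ => ?_
    ring
end

section
/- On the half-line, the operators (β_∞f)(s) = f(s) − ∫_s^∞ (f(u)/A(u)) z(u)² du and (α_∞f)(s) = f(s) − A(s)⁻¹ ∫₀^s f(u) z(u)² du are mutually inverse isometric isomorphisms of L²([0,∞), z(s)² ds): for every f in this space, ∫₀^∞ (β_∞f)(s)² z(s)² ds = ∫₀^∞ f(s)² z(s)² ds, ∫₀^∞ (α_∞f)(s)² z(s)² ds = ∫₀^∞ f(s)² z(s)² ds, and α_∞(β_∞f) = f and β_∞(α_∞f) = f almost everywhere. -/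
open MeasureTheory Set
open Filter Topology

section General

variable {F G p k k₀ Φ : ℝ → ℝ} {a b : ℝ}

theorem AbsolutelyContinuousOnInterval.of_dist_le (hF : AbsolutelyContinuousOnInterval F a b)
    {K : ℝ} (hK : 0 < K)
    (h : ∀ x ∈ uIcc a b, ∀ y ∈ uIcc a b, dist (G x) (G y) ≤ K * dist (F x) (F y)) :
    AbsolutelyContinuousOnInterval G a b := by
  rw [absolutelyContinuousOnInterval_iff] at hF ⊢
  intro ε hε
  obtain ⟨δ, hδ, H⟩ := hF (ε / K) (by positivity)
  refine ⟨δ, hδ, fun E hE hEδ => ?_⟩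
  calc ∑ i ∈ Finset.range E.1, dist (G (E.2 i).1) (G (E.2 i).2)
      ≤ ∑ i ∈ Finset.range E.1, K * dist (F (E.2 i).1) (F (E.2 i).2) :=
        Finset.sum_le_sum fun i hi => h _ (hE.1 i hi).1 _ (hE.1 i hi).2
    _ = K * ∑ i ∈ Finset.range E.1, dist (F (E.2 i).1) (F (E.2 i).2) := by
        rw [Finset.mul_sum]
    _ < K * (ε / K) := by gcongr; exact H E hE hEδ
    _ = ε := by field_simp

theorem AbsolutelyContinuousOnInterval.inv_of_le_s14 (hF : AbsolutelyContinuousOnInterval F a b)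
    {m : ℝ} (hm : 0 < m) (h : ∀ x ∈ uIcc a b, m ≤ F x) :
    AbsolutelyContinuousOnInterval (fun x => (F x)⁻¹) a b := by
  refine hF.of_dist_le (K := (m ^ 2)⁻¹) (by positivity) fun x hx y hy => ?_
  have hx' := hm.trans_le (h x hx)
  have hy' := hm.trans_le (h y hy)
  rw [dist_inv_inv₀ hx'.ne' hy'.ne', Real.norm_of_nonneg hx'.le, Real.norm_of_nonneg hy'.le,
    div_eq_inv_mul]
  gcongr
  nlinarith [h x hx, h y hy]

theorem AbsolutelyContinuousOnInterval.integral_eq_sub_of_ae_hasDerivAt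
    (hF : AbsolutelyContinuousOnInterval F a b)
    (h : ∀ᵐ x, x ∈ uIcc a b → HasDerivAt F (p x) x) :
    IntervalIntegrable p volume a b ∧ ∫ x in a..b, p x = F b - F a := by
  have e : ∀ᵐ x, x ∈ uIoc a b → deriv F x = p x := by
    filter_upwards [h] with x hx hx' using (hx (uIoc_subset_uIcc hx')).deriv
  refine ⟨hF.intervalIntegrable_deriv.congr_ae ?_, ?_⟩
  · exact (ae_restrict_iff' measurableSet_uIoc).2 e
  · rw [← hF.integral_deriv_eq_sub]
    exact (intervalIntegral.integral_congr_ae e).symm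

theorem sq_integral_mul_le {α : Type*} [MeasurableSpace α] {μ : Measure α} {u v : α → ℝ}
    (hu : MemLp u 2 μ) (hv : MemLp v 2 μ) :
    (∫ x, u x * v x ∂μ) ^ 2 ≤ (∫ x, u x ^ 2 ∂μ) * ∫ x, v x ^ 2 ∂μ := by
  have iuv : Integrable (fun x => u x * v x) μ := hu.integrable_mul hv
  have h := discrim_le_zero (a := ∫ x, v x ^ 2 ∂μ) (b := 2 * ∫ x, u x * v x ∂μ)
    (c := ∫ x, u x ^ 2 ∂μ) fun r => by
      have : ∫ x, (u x + r * v x) ^ 2 ∂μ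
          = ∫ x, (u x ^ 2 + (2 * r) * (u x * v x)) + r ^ 2 * v x ^ 2 ∂μ := by
        congr 1 with x; ring
      have iu : Integrable (fun x => u x ^ 2 + (2 * r) * (u x * v x)) μ :=
        hu.integrable_sq.add (iuv.const_mul _)
      rw [integral_add iu (hv.integrable_sq.const_mul _),
        integral_add hu.integrable_sq (iuv.const_mul _), integral_const_mul,
        integral_const_mul] at this
      have h0 : 0 ≤ ∫ x, (u x + r * v x) ^ 2 ∂μ := integral_nonneg fun x => sq_nonneg _
      linarith
  rw [discrim] at h
  nlinarith

theorem tendsto_zero_of_eventually_le {ι κ : Type*} {l : Filter ι} {l' : Filter κ} [l'.NeBot]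
    {Φ m : ι → ℝ} {e c : κ → ℝ} (he : Tendsto e l' (𝓝 0)) (hm : Tendsto m l (𝓝 0))
    (h0 : ∀ᶠ s in l, 0 ≤ Φ s) (h : ∀ᶠ R in l', ∀ᶠ s in l, Φ s ≤ e R + c R * m s) :
    Tendsto Φ l (𝓝 0) := by
  refine tendsto_order.2 ⟨fun a ha => h0.mono fun s hs => ha.trans_le hs, fun a ha => ?_⟩
  obtain ⟨R, hR, hR'⟩ := (h.and (he.eventually_lt_const ha)).exists
  have : Tendsto (fun s => e R + c R * m s) l (𝓝 (e R)) := by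
    simpa using (hm.const_mul (c R)).const_add (e R)
  filter_upwards [hR, this.eventually_lt_const hR'] with s h1 h2 using h1.trans_lt h2

theorem integral_Ioi_eq_of_integral_sub_eq (hk : ∀ x, 0 ≤ k x)
    (hk₀ : IntegrableOn k₀ (Ioi 0))
    (h : ∀ a b, 0 < a → a ≤ b → IntervalIntegrable (fun x => k x - k₀ x) volume a b ∧
      ∫ x in a..b, (k x - k₀ x) = Φ b - Φ a)
    (hΦ₀ : Tendsto Φ (𝓝[>] 0) (𝓝 0)) (hΦ : Tendsto Φ atTop (𝓝 0)) :
    IntegrableOn k (Ioi 0) ∧ ∫ x in Ioi 0, k x = ∫ x in Ioi 0, k₀ x := by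
  set u : ℕ → ℝ := fun n => 1 / ((n : ℝ) + 1)
  set v : ℕ → ℝ := fun n => (n : ℝ) + 1
  have hu0 : ∀ n, 0 < u n := fun n => by positivity
  have huv : ∀ n, u n ≤ v n := fun n => by
    have : (1 : ℝ) ≤ n + 1 := by simp
    exact ((div_le_one (by positivity)).2 this).trans this
  have hu : Tendsto u atTop (𝓝 0) := tendsto_one_div_add_atTop_nhds_zero_nat
  have hv : Tendsto v atTop atTop := tendsto_atTop_add_const_right _ _ tendsto_natCast_atTop_atTop
  have cov : AECover (volume.restrict (Ioi (0 : ℝ))) atTop fun n => Ioc (u n) (v n) :=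
    (aecover_Ioi_of_Ioi hu).inter (aecover_Iic hv)
  have res : ∀ n, (volume.restrict (Ioi (0 : ℝ))).restrict (Ioc (u n) (v n))
      = volume.restrict (Ioc (u n) (v n)) := fun n =>
    Measure.restrict_restrict_of_subset fun x hx => (hu0 n).trans hx.1
  have ik₀ : ∀ n, IntegrableOn k₀ (Ioc (u n) (v n)) := fun n =>
    hk₀.mono_set fun x hx => (hu0 n).trans hx.1
  have id : ∀ n, IntegrableOn (fun x => k x - k₀ x) (Ioc (u n) (v n)) := fun n =>
    (intervalIntegrable_iff_integrableOn_Ioc_of_le (huv n)).1 (h _ _ (hu0 n) (huv n)).1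
  have ik : ∀ n, IntegrableOn k (Ioc (u n) (v n)) := fun n =>
    ((id n).add (ik₀ n)).congr (Eventually.of_forall fun x => sub_add_cancel (k x) (k₀ x))
  have ik' : ∀ n, IntegrableOn k (Ioc (u n) (v n)) (volume.restrict (Ioi 0)) := fun n => by
    rw [IntegrableOn, res]; exact ik n
  have t₀ := cov.integral_tendsto_of_countably_generated hk₀
  have hu' : Tendsto u atTop (𝓝[>] 0) :=
    tendsto_nhdsWithin_iff.2 ⟨hu, Eventually.of_forall hu0⟩
  have t : Tendsto (fun n => ∫ x in Ioc (u n) (v n), k x ∂(volume.restrict (Ioi 0))) atTop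
      (𝓝 (∫ x in Ioi 0, k₀ x)) := by
    have := t₀.add ((hΦ.comp hv).sub (hΦ₀.comp hu'))
    simp only [sub_zero, add_zero] at this
    refine this.congr fun n => ?_
    have e := (h _ _ (hu0 n) (huv n)).2
    rw [intervalIntegral.integral_of_le (huv n), integral_sub (ik n) (ik₀ n)] at e
    simp only [Function.comp_apply, res, ← e]
    ring
  have nn : ∀ᵐ x ∂(volume.restrict (Ioi (0 : ℝ))), 0 ≤ k x := Eventually.of_forall hk
  exact ⟨cov.integrable_of_integral_tendsto_of_nonneg_ae _ ik' nn t,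
    cov.integral_eq_of_tendsto_of_nonneg_ae _ nn ik' t⟩

theorem IntervalIntegrable.absolutelyContinuousOnInterval_primitive {p : ℝ → ℝ} {a b : ℝ}
    (ha : 0 ≤ a) (hab : a ≤ b) (hp : IntervalIntegrable p volume 0 b) :
    AbsolutelyContinuousOnInterval (fun x => ∫ t in (0 : ℝ)..x, p t) a b ∧
      ∀ᵐ x, x ∈ uIcc a b → HasDerivAt (fun x => ∫ t in (0 : ℝ)..x, p t) (p x) x := by
  have sub : uIcc a b ⊆ uIcc 0 b := by
    rw [uIcc_of_le hab, uIcc_of_le (ha.trans hab)]; exact Icc_subset_Icc_left ha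
  refine ⟨(hp.absolutelyContinuousOnInterval_intervalIntegral left_mem_uIcc).mono sub, ?_⟩
  filter_upwards [hp.ae_hasDerivAt_integral] with x hx hx' using hx (sub hx') 0 left_mem_uIcc

theorem tendsto_primitive_nhdsGT_zero {p : ℝ → ℝ} (hp : IntegrableOn p (Ioi 0)) :
    Tendsto (fun s => ∫ u in (0 : ℝ)..s, p u) (𝓝[>] 0) (𝓝 0) := by
  have ii : IntervalIntegrable p volume 0 1 :=
    (intervalIntegrable_iff_integrableOn_Ioc_of_le zero_le_one).2 (hp.mono_set Ioc_subset_Ioi_self)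
  have hc := (ii.absolutelyContinuousOnInterval_primitive le_rfl zero_le_one).1.continuousOn 0
    left_mem_uIcc
  rw [ContinuousWithinAt, intervalIntegral.integral_same, uIcc_of_le zero_le_one] at hc
  exact hc.mono_left (nhdsWithin_le_of_mem (Icc_mem_nhdsGT zero_lt_one))

theorem absolutelyContinuousOnInterval_integral_Ioi {p : ℝ → ℝ} {a b : ℝ}
    (ha : 0 < a) (hab : a ≤ b) (hp : ∀ s > 0, IntegrableOn p (Ioi s)) :
    AbsolutelyContinuousOnInterval (fun x => ∫ t in Ioi x, p t) a b ∧
      ∀ᵐ x, x ∈ uIcc a b → HasDerivAt (fun x => ∫ t in Ioi x, p t) (-p x) x := by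
  have key : ∀ x > 0, ∫ t in Ioi x, p t = (∫ t in Ioi a, p t) - ∫ t in a..x, p t :=
    fun x hx => by rw [← intervalIntegral.integral_Ioi_sub_Ioi' (hp a ha) (hp x hx)]; ring
  have pos : ∀ x ∈ uIcc a b, 0 < x := fun x hx => by
    rw [uIcc_of_le hab] at hx; exact ha.trans_le hx.1
  have ii : IntervalIntegrable p volume a b :=
    (intervalIntegrable_iff_integrableOn_Ioc_of_le hab).2
      ((hp a ha).mono_set Ioc_subset_Ioi_self)
  constructor
  · have h := (ii.absolutelyContinuousOnInterval_intervalIntegral left_mem_uIcc).fun_neg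
    refine h.of_dist_le one_pos fun x hx y hy => ?_
    rw [key x (pos x hx), key y (pos y hy), one_mul, sub_eq_add_neg, sub_eq_add_neg, dist_add_left]
  · filter_upwards [ii.ae_hasDerivAt_integral] with x hx hx'
    refine ((hx hx' a left_mem_uIcc).const_sub (∫ t in Ioi a, p t)).congr_of_eventuallyEq ?_
    filter_upwards [Ioi_mem_nhds (pos x hx')] with y hy using key y hy

end General

/-- `A` is the primitive vanishing at `0` of the weight `z ^ 2`, which is locally integrable and
almost everywhere positive on the half-line and has infinite total mass. -/
structure IsHalflineClock (z A : ℝ → ℝ) : Prop where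
  measurable : Measurable z
  integrableOn : ∀ t > (0 : ℝ), IntegrableOn (fun s => z s ^ 2) (Ioc 0 t)
  ae_ne_zero : ∀ᵐ s ∂(volume.restrict (Ioi (0 : ℝ))), z s ≠ 0
  eq_integral : ∀ t, A t = ∫ s in (0 : ℝ)..t, z s ^ 2
  tendsto_atTop : Tendsto A atTop atTop

namespace IsHalflineClock

variable {z A g : ℝ → ℝ} {a b s t : ℝ}

theorem intervalIntegrable (h : IsHalflineClock z A)
    (hb : 0 ≤ b) : IntervalIntegrable (fun s => z s ^ 2) volume 0 b := by
  rcases hb.eq_or_lt with rfl | hb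
  · simp
  · exact (intervalIntegrable_iff_integrableOn_Ioc_of_le hb.le).2 (h.integrableOn b hb)

theorem sub_eq (h : IsHalflineClock z A)
    (ha : 0 ≤ a) (hb : 0 ≤ b) : A b - A a = ∫ s in a..b, z s ^ 2 := by
  rw [h.eq_integral, h.eq_integral, intervalIntegral.integral_interval_sub_left
    (h.intervalIntegrable hb) (h.intervalIntegrable ha)]

theorem mono (h : IsHalflineClock z A) (ha : 0 ≤ a) (hab : a ≤ b) : A a ≤ A b := by
  have := h.sub_eq ha (ha.trans hab)
  have := intervalIntegral.integral_nonneg_of_forall (μ := volume) hab fun s => sq_nonneg (z s)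
  linarith

theorem zero (h : IsHalflineClock z A) : A 0 = 0 := by simp [h.eq_integral]

theorem pos (h : IsHalflineClock z A) (ht : 0 < t) : 0 < A t := by
  rw [h.eq_integral, intervalIntegral.integral_of_le ht.le]
  refine (integral_nonneg fun s => sq_nonneg (z s)).lt_of_ne' fun h0 => ?_
  rw [integral_eq_zero_iff_of_nonneg (fun s => sq_nonneg (z s)) (h.integrableOn t ht)] at h0
  have hF : ∀ᵐ s ∂(volume.restrict (Ioc 0 t)), False := by
    filter_upwards [h0, ae_mono (Measure.restrict_mono Ioc_subset_Ioi_self le_rfl) h.ae_ne_zero]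
      with s h1 h2 using h2 (pow_eq_zero_iff two_ne_zero |>.1 h1)
  rw [eventually_false_iff_eq_bot, ae_eq_bot, Measure.restrict_eq_zero, Real.volume_Ioc] at hF
  simp [ht.not_ge] at hF

theorem absolutelyContinuous (h : IsHalflineClock z A)
    (ha : 0 ≤ a) (hab : a ≤ b) : AbsolutelyContinuousOnInterval A a b ∧
    ∀ᵐ x, x ∈ uIcc a b → HasDerivAt A (z x ^ 2) x := by
  rw [show A = fun t => ∫ s in (0 : ℝ)..t, z s ^ 2 from funext h.eq_integral]
  exact IntervalIntegrable.absolutelyContinuousOnInterval_primitive ha hab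
    (h.intervalIntegrable (ha.trans hab))

theorem absolutelyContinuous_inv (h : IsHalflineClock z A) (ha : 0 < a) (hab : a ≤ b) :
    AbsolutelyContinuousOnInterval (fun x => (A x)⁻¹) a b ∧
      ∀ᵐ x, x ∈ uIcc a b → HasDerivAt (fun x => (A x)⁻¹) (-z x ^ 2 / A x ^ 2) x := by
  have ge : ∀ x ∈ uIcc a b, A a ≤ A x := fun x hx => by
    rw [uIcc_of_le hab] at hx; exact h.mono ha.le hx.1
  obtain ⟨hA, hd⟩ := h.absolutelyContinuous ha.le hab
  refine ⟨hA.inv_of_le_s14 (h.pos ha) ge, ?_⟩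
  filter_upwards [hd] with x hx hx'
  exact (hx hx').fun_inv ((h.pos ha).trans_le (ge x hx')).ne'

theorem tendsto_nhdsGT_zero (h : IsHalflineClock z A) : Tendsto A (𝓝[>] 0) (𝓝 0) := by
  have hc := (h.absolutelyContinuous le_rfl zero_le_one).1.continuousOn 0 left_mem_uIcc
  rw [ContinuousWithinAt, h.zero, uIcc_of_le zero_le_one] at hc
  exact hc.mono_left (nhdsWithin_le_of_mem (Icc_mem_nhdsGT zero_lt_one))

theorem integral_Ioi_div_sq (h : IsHalflineClock z A) (hs : 0 < s) :
    IntegrableOn (fun x => (z x / A x) ^ 2) (Ioi s) ∧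
      ∫ x in Ioi s, (z x / A x) ^ 2 = (A s)⁻¹ := by
  have hd : ∀ b ≥ s, IntervalIntegrable (fun x => (z x / A x) ^ 2) volume s b ∧
      ∫ x in s..b, (z x / A x) ^ 2 = (A s)⁻¹ - (A b)⁻¹ := fun b hb => by
    obtain ⟨hA, hd⟩ := h.absolutelyContinuous_inv hs hb
    have := hA.fun_neg.integral_eq_sub_of_ae_hasDerivAt (p := fun x => (z x / A x) ^ 2) (by
      filter_upwards [hd] with x hx hx'
      exact (hx hx').fun_neg.congr_deriv (by ring))
    exact ⟨this.1, this.2.trans (by ring)⟩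
  have cov : AECover (volume.restrict (Ioi s)) atTop fun n : ℕ => Iic (s + (n : ℝ)) :=
    aecover_Iic (tendsto_atTop_add_const_left _ _ tendsto_natCast_atTop_atTop)
  have le : ∀ n : ℕ, s ≤ s + n := fun n => by simp
  have res : ∀ n : ℕ, (volume.restrict (Ioi s)).restrict (Iic (s + (n : ℝ)))
      = volume.restrict (Ioc s (s + n)) := fun n => by
    rw [Measure.restrict_restrict measurableSet_Iic, inter_comm, Ioi_inter_Iic]
  have i : ∀ n : ℕ, IntegrableOn (fun x => (z x / A x) ^ 2) (Iic (s + (n : ℝ)))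
      (volume.restrict (Ioi s)) := fun n => by
    rw [IntegrableOn, res]
    exact (intervalIntegrable_iff_integrableOn_Ioc_of_le (le n)).1 (hd _ (le n)).1
  have t : Tendsto (fun n : ℕ => ∫ x in Iic (s + (n : ℝ)), (z x / A x) ^ 2
      ∂(volume.restrict (Ioi s))) atTop (𝓝 (A s)⁻¹) := by
    have := (tendsto_inv_atTop_zero.comp (h.tendsto_atTop.comp (tendsto_atTop_add_const_left
      atTop s tendsto_natCast_atTop_atTop))).const_sub (A s)⁻¹
    rw [sub_zero] at this
    refine this.congr fun n => ?_
    rw [res, ← intervalIntegral.integral_of_le (le n), (hd _ (le n)).2]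
    rfl
  have nn : ∀ᵐ x ∂(volume.restrict (Ioi s)), 0 ≤ (z x / A x) ^ 2 :=
    Eventually.of_forall fun x => sq_nonneg _
  exact ⟨cov.integrable_of_integral_tendsto_of_nonneg_ae _ i nn t,
    cov.integral_eq_of_tendsto_of_nonneg_ae _ nn i t⟩

theorem continuousOn (h : IsHalflineClock z A) : ContinuousOn A (Ioi 0) := fun x hx => by
  have hx : 0 < x := hx
  have hc := (h.absolutelyContinuous le_rfl (b := x + 1) (by linarith)).1.continuousOn
  rw [uIcc_of_le (by linarith)] at hc
  exact (hc.continuousAt (Icc_mem_nhds hx (by linarith))).continuousWithinAt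

theorem memLp_Ioc (h : IsHalflineClock z A) (ht : 0 < t) : MemLp z 2 (volume.restrict (Ioc 0 t)) :=
  (memLp_two_iff_integrable_sq h.measurable.aestronglyMeasurable).2 (h.integrableOn t ht)

theorem memLp_Ioi (h : IsHalflineClock z A)
    (hs : 0 < s) : MemLp (fun x => z x / A x) 2 (volume.restrict (Ioi s)) := by
  refine (memLp_two_iff_integrable_sq ?_).2 (h.integral_Ioi_div_sq hs).1
  exact (h.measurable.aemeasurable.div ((h.continuousOn.mono
    (Ioi_subset_Ioi hs.le)).aemeasurable measurableSet_Ioi)).aestronglyMeasurable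

theorem memLp_mul (h : IsHalflineClock z A) (hg : AEStronglyMeasurable g (volume.restrict (Ioi 0)))
    (hg2 : IntegrableOn (fun s => g s ^ 2 * z s ^ 2) (Ioi 0)) :
    MemLp (fun s => g s * z s) 2 (volume.restrict (Ioi 0)) := by
  refine (memLp_two_iff_integrable_sq (hg.mul h.measurable.aestronglyMeasurable)).2 ?_
  simpa only [IntegrableOn, Pi.mul_apply, mul_pow] using hg2

theorem integrableOn_mul (h : IsHalflineClock z A)
    (hg : AEStronglyMeasurable g (volume.restrict (Ioi 0)))
    (hg2 : IntegrableOn (fun s => g s ^ 2 * z s ^ 2) (Ioi 0)) (ht : 0 < t) :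
    IntegrableOn (fun s => g s * z s ^ 2) (Ioc 0 t) := by
  have := ((h.memLp_mul hg hg2).mono_measure
    (Measure.restrict_mono Ioc_subset_Ioi_self le_rfl)).integrable_mul (h.memLp_Ioc ht)
  exact this.congr (Eventually.of_forall fun x => by simp only [Pi.mul_apply]; ring)

theorem intervalIntegrable_mul (h : IsHalflineClock z A)
    (hg : AEStronglyMeasurable g (volume.restrict (Ioi 0)))
    (hg2 : IntegrableOn (fun s => g s ^ 2 * z s ^ 2) (Ioi 0)) (ht : 0 ≤ t) :
    IntervalIntegrable (fun s => g s * z s ^ 2) volume 0 t := by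
  rcases ht.eq_or_lt with rfl | ht
  · simp
  · exact (intervalIntegrable_iff_integrableOn_Ioc_of_le ht.le).2 (h.integrableOn_mul hg hg2 ht)

theorem integrableOn_div (h : IsHalflineClock z A)
    (hg : AEStronglyMeasurable g (volume.restrict (Ioi 0)))
    (hg2 : IntegrableOn (fun s => g s ^ 2 * z s ^ 2) (Ioi 0)) (hs : 0 < s) :
    IntegrableOn (fun s => g s / A s * z s ^ 2) (Ioi s) := by
  have := ((h.memLp_mul hg hg2).mono_measure
    (Measure.restrict_mono (Ioi_subset_Ioi hs.le) le_rfl)).integrable_mul (h.memLp_Ioi hs)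
  exact this.congr (Eventually.of_forall fun x => by simp only [Pi.mul_apply]; ring)

theorem sq_setIntegral_mul_le (h : IsHalflineClock z A)
    (hg : AEStronglyMeasurable g (volume.restrict (Ioi 0)))
    (hg2 : IntegrableOn (fun s => g s ^ 2 * z s ^ 2) (Ioi 0)) (ht : 0 < t) {S : Set ℝ}
    (hS : S ⊆ Ioc 0 t) :
    (∫ s in S, g s * z s ^ 2) ^ 2 ≤ (∫ s in S, g s ^ 2 * z s ^ 2) * A t := by
  have cs := sq_integral_mul_le
    ((h.memLp_mul hg hg2).mono_measure
      (Measure.restrict_mono (hS.trans Ioc_subset_Ioi_self) le_rfl))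
    ((h.memLp_Ioc ht).mono_measure (Measure.restrict_mono hS le_rfl))
  simp only [mul_pow, mul_assoc, ← pow_two] at cs
  refine cs.trans (mul_le_mul_of_nonneg_left ?_ (integral_nonneg fun s => by positivity))
  rw [h.eq_integral, intervalIntegral.integral_of_le ht.le]
  exact setIntegral_mono_set (h.integrableOn t ht)
    (Eventually.of_forall fun s => sq_nonneg _) (LE.le.eventuallyLE hS)

theorem sq_setIntegral_div_le (h : IsHalflineClock z A)
    (hg : AEStronglyMeasurable g (volume.restrict (Ioi 0)))
    (hg2 : IntegrableOn (fun s => g s ^ 2 * z s ^ 2) (Ioi 0)) (hs : 0 < s) {S : Set ℝ}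
    (hS : S ⊆ Ioi s) :
    (∫ x in S, g x / A x * z x ^ 2) ^ 2 ≤ (∫ x in S, g x ^ 2 * z x ^ 2) * (A s)⁻¹ := by
  have cs := sq_integral_mul_le
    ((h.memLp_mul hg hg2).mono_measure
      (Measure.restrict_mono (hS.trans (Ioi_subset_Ioi hs.le)) le_rfl))
    ((h.memLp_Ioi hs).mono_measure (Measure.restrict_mono hS le_rfl))
  simp only [mul_pow] at cs
  rw [show (fun x => g x / A x * z x ^ 2) = fun x => g x * z x * (z x / A x) by ext x; ring]
  refine cs.trans (mul_le_mul_of_nonneg_left ?_ (integral_nonneg fun s => by positivity))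
  rw [← (h.integral_Ioi_div_sq hs).2]
  exact setIntegral_mono_set (h.integral_Ioi_div_sq hs).1
    (Eventually.of_forall fun s => sq_nonneg _) (LE.le.eventuallyLE hS)

theorem tendsto_sq_primitive_div (h : IsHalflineClock z A)
    (hg : AEStronglyMeasurable g (volume.restrict (Ioi 0)))
    (hg2 : IntegrableOn (fun s => g s ^ 2 * z s ^ 2) (Ioi 0)) :
    Tendsto (fun s => (∫ u in (0 : ℝ)..s, g u * z u ^ 2) ^ 2 / A s) (𝓝[>] 0) (𝓝 0) ∧
      Tendsto (fun s => (∫ u in (0 : ℝ)..s, g u * z u ^ 2) ^ 2 / A s) atTop (𝓝 0) := by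
  constructor
  · refine squeeze_zero' (g := fun s => ∫ u in (0 : ℝ)..s, g u ^ 2 * z u ^ 2) ?_ ?_
      (tendsto_primitive_nhdsGT_zero hg2)
    · filter_upwards [self_mem_nhdsWithin] with s hs
      have := h.pos hs
      positivity
    · filter_upwards [self_mem_nhdsWithin] with s hs
      have hs : 0 < s := hs
      rw [div_le_iff₀ (h.pos hs), intervalIntegral.integral_of_le hs.le,
        intervalIntegral.integral_of_le hs.le]
      exact h.sq_setIntegral_mul_le hg hg2 hs subset_rfl
  · refine tendsto_zero_of_eventually_le (l' := atTop)
      (e := fun R => 2 * ∫ u in Ioi R, g u ^ 2 * z u ^ 2) (m := fun s => (A s)⁻¹)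
      (c := fun R => 2 * (∫ u in (0 : ℝ)..R, g u * z u ^ 2) ^ 2)
      (by simpa using (tendsto_integral_Ioi_zero tendsto_id).const_mul (2 : ℝ))
      (tendsto_inv_atTop_zero.comp h.tendsto_atTop) ?_ ?_
    · filter_upwards [eventually_gt_atTop 0] with s hs
      have := h.pos hs
      positivity
    · filter_upwards [eventually_gt_atTop 0] with R hR
      filter_upwards [eventually_ge_atTop R] with s hs
      have hs0 : 0 < s := hR.trans_le hs
      have hA := h.pos hs0
      have i0 := h.intervalIntegrable_mul hg hg2 hR.le
      have i1 := h.intervalIntegrable_mul hg hg2 hs0.le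
      have split := intervalIntegral.integral_interval_sub_left i1 i0
      have cs := h.sq_setIntegral_mul_le hg hg2 hs0 (S := Ioc R s) (Ioc_subset_Ioc_left hR.le)
      rw [← intervalIntegral.integral_of_le hs] at cs
      have le : ∫ u in Ioc R s, g u ^ 2 * z u ^ 2 ≤ ∫ u in Ioi R, g u ^ 2 * z u ^ 2 :=
        setIntegral_mono_set (hg2.mono_set (Ioi_subset_Ioi hR.le))
          (Eventually.of_forall fun u => by simp only [Pi.zero_apply]; positivity)
          (LE.le.eventuallyLE Ioc_subset_Ioi_self)
      have le' := mul_le_mul_of_nonneg_right le hA.le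
      have e : ∫ u in (0 : ℝ)..s, g u * z u ^ 2 = (∫ u in R..s, g u * z u ^ 2) +
        ∫ u in (0 : ℝ)..R, g u * z u ^ 2 := by linarith
      rw [e, div_le_iff₀ hA, add_mul, mul_assoc _ (A s)⁻¹, inv_mul_cancel₀ hA.ne']
      nlinarith [sq_nonneg ((∫ u in R..s, g u * z u ^ 2) - ∫ u in (0 : ℝ)..R, g u * z u ^ 2)]

theorem tendsto_mul_sq_tail (h : IsHalflineClock z A)
    (hg : AEStronglyMeasurable g (volume.restrict (Ioi 0)))
    (hg2 : IntegrableOn (fun s => g s ^ 2 * z s ^ 2) (Ioi 0)) :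
    Tendsto (fun s => A s * (∫ u in Ioi s, g u / A u * z u ^ 2) ^ 2) (𝓝[>] 0) (𝓝 0) ∧
      Tendsto (fun s => A s * (∫ u in Ioi s, g u / A u * z u ^ 2) ^ 2) atTop (𝓝 0) := by
  constructor
  · refine tendsto_zero_of_eventually_le (l' := 𝓝[>] 0)
      (e := fun R => 2 * ∫ u in (0 : ℝ)..R, g u ^ 2 * z u ^ 2) (m := A)
      (c := fun R => 2 * (∫ u in Ioi R, g u / A u * z u ^ 2) ^ 2)
      (by simpa using (tendsto_primitive_nhdsGT_zero hg2).const_mul (2 : ℝ))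
      h.tendsto_nhdsGT_zero ?_ ?_
    · filter_upwards [self_mem_nhdsWithin] with s hs
      have := h.pos hs
      positivity
    · filter_upwards [self_mem_nhdsWithin] with R hR
      filter_upwards [Ioc_mem_nhdsGT hR] with s hs
      have hA := h.pos hs.1
      have split := intervalIntegral.integral_Ioi_sub_Ioi (h.integrableOn_div hg hg2 hs.1) hs.2
      have cs := h.sq_setIntegral_div_le hg hg2 hs.1 (S := Ioc s R) Ioc_subset_Ioi_self
      rw [← intervalIntegral.integral_of_le hs.2, ← div_eq_mul_inv, le_div_iff₀ hA] at cs
      have le : ∫ u in Ioc s R, g u ^ 2 * z u ^ 2 ≤ ∫ u in (0 : ℝ)..R, g u ^ 2 * z u ^ 2 := by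
        rw [intervalIntegral.integral_of_le hR.out.le]
        exact setIntegral_mono_set (hg2.mono_set Ioc_subset_Ioi_self)
          (Eventually.of_forall fun u => by simp only [Pi.zero_apply]; positivity)
          (LE.le.eventuallyLE (Ioc_subset_Ioc_left hs.1.le))
      have e : ∫ u in Ioi s, g u / A u * z u ^ 2 = (∫ u in s..R, g u / A u * z u ^ 2) +
        ∫ u in Ioi R, g u / A u * z u ^ 2 := by linarith
      rw [e]
      nlinarith [mul_nonneg hA.le (sq_nonneg ((∫ u in s..R, g u / A u * z u ^ 2) -
        ∫ u in Ioi R, g u / A u * z u ^ 2))]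
  · refine squeeze_zero' (g := fun s => ∫ u in Ioi s, g u ^ 2 * z u ^ 2) ?_ ?_
      (tendsto_integral_Ioi_zero tendsto_id)
    · filter_upwards [eventually_gt_atTop 0] with s hs
      have := h.pos hs
      positivity
    · filter_upwards [eventually_gt_atTop 0] with s hs
      rw [mul_comm, ← le_div_iff₀ (h.pos hs), div_eq_mul_inv]
      exact h.sq_setIntegral_div_le hg hg2 hs subset_rfl

theorem integral_sq_sub_tail (h : IsHalflineClock z A)
    (hg : AEStronglyMeasurable g (volume.restrict (Ioi 0)))
    (hg2 : IntegrableOn (fun s => g s ^ 2 * z s ^ 2) (Ioi 0)) :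
    IntegrableOn (fun s => (g s - ∫ u in Ioi s, g u / A u * z u ^ 2) ^ 2 * z s ^ 2) (Ioi 0) ∧
      ∫ s in Ioi 0, (g s - ∫ u in Ioi s, g u / A u * z u ^ 2) ^ 2 * z s ^ 2
        = ∫ s in Ioi 0, g s ^ 2 * z s ^ 2 := by
  refine integral_Ioi_eq_of_integral_sub_eq (fun x => by positivity) hg2 ?_
    (h.tendsto_mul_sq_tail hg hg2).1 (h.tendsto_mul_sq_tail hg hg2).2
  intro a b ha hab
  obtain ⟨hA, dA⟩ := h.absolutelyContinuous ha.le hab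
  obtain ⟨hG, dG⟩ := absolutelyContinuousOnInterval_integral_Ioi ha hab
    fun s hs => h.integrableOn_div hg hg2 hs
  simp only [pow_two (∫ u in Ioi _, g u / A u * z u ^ 2)]
  refine (hA.fun_mul (hG.fun_mul hG)).integral_eq_sub_of_ae_hasDerivAt ?_
  filter_upwards [dA, dG] with x h1 h2 hx
  have hx0 : 0 < x := by rw [uIcc_of_le hab] at hx; exact ha.trans_le hx.1
  have := (h.pos hx0).ne'
  refine ((h1 hx).fun_mul ((h2 hx).fun_mul (h2 hx))).congr_deriv ?_
  field_simp
  ring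

theorem integral_sq_sub_average (h : IsHalflineClock z A)
    (hg : AEStronglyMeasurable g (volume.restrict (Ioi 0)))
    (hg2 : IntegrableOn (fun s => g s ^ 2 * z s ^ 2) (Ioi 0)) :
    IntegrableOn (fun s => (g s - (A s)⁻¹ * ∫ u in (0 : ℝ)..s, g u * z u ^ 2) ^ 2 * z s ^ 2)
        (Ioi 0) ∧
      ∫ s in Ioi 0, (g s - (A s)⁻¹ * ∫ u in (0 : ℝ)..s, g u * z u ^ 2) ^ 2 * z s ^ 2
        = ∫ s in Ioi 0, g s ^ 2 * z s ^ 2 := by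
  refine integral_Ioi_eq_of_integral_sub_eq (fun x => by positivity) hg2 ?_
    (by simpa using (h.tendsto_sq_primitive_div hg hg2).1.neg)
    (by simpa using (h.tendsto_sq_primitive_div hg hg2).2.neg)
  intro a b ha hab
  obtain ⟨hA, dA⟩ := h.absolutelyContinuous_inv ha hab
  obtain ⟨hF, dF⟩ := IntervalIntegrable.absolutelyContinuousOnInterval_primitive ha.le hab
    (h.intervalIntegrable_mul hg hg2 (ha.le.trans hab))
  simp only [pow_two (∫ u in (0 : ℝ).._, g u * z u ^ 2), div_eq_mul_inv]
  refine ((hF.fun_mul hF).fun_mul hA).fun_neg.integral_eq_sub_of_ae_hasDerivAt ?_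
  filter_upwards [dA, dF] with x h1 h2 hx
  have hx0 : 0 < x := by rw [uIcc_of_le hab] at hx; exact ha.trans_le hx.1
  have := (h.pos hx0).ne'
  refine (((h2 hx).fun_mul (h2 hx)).fun_mul (h1 hx)).fun_neg.congr_deriv ?_
  field_simp
  ring

theorem integral_sub_tail (h : IsHalflineClock z A)
    (hg : AEStronglyMeasurable g (volume.restrict (Ioi 0)))
    (hg2 : IntegrableOn (fun s => g s ^ 2 * z s ^ 2) (Ioi 0)) (hs : 0 < s) :
    ∫ x in (0 : ℝ)..s, (g x - ∫ u in Ioi x, g u / A u * z u ^ 2) * z x ^ 2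
      = -(A s * ∫ u in Ioi s, g u / A u * z u ^ 2) := by
  set G : ℝ → ℝ := fun x => ∫ u in Ioi x, g u / A u * z u ^ 2
  have hac : ∀ a b, 0 < a → a ≤ b → AbsolutelyContinuousOnInterval G a b ∧
      ∀ᵐ x, x ∈ uIcc a b → HasDerivAt G (-(g x / A x * z x ^ 2)) x := fun a b ha hab =>
    absolutelyContinuousOnInterval_integral_Ioi ha hab
      fun s hs => h.integrableOn_div hg hg2 hs
  have hGc : ContinuousOn G (Ioi 0) := fun x hx => by
    have hx : 0 < x := hx
    have hc := (hac (x / 2) (x + 1) (by linarith) (by linarith)).1.continuousOn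
    rw [uIcc_of_le (by linarith)] at hc
    exact (hc.continuousAt (Icc_mem_nhds (by linarith) (by linarith))).continuousWithinAt
  have hk : AEStronglyMeasurable (fun x => g x - G x) (volume.restrict (Ioi 0)) :=
    hg.sub (hGc.aestronglyMeasurable measurableSet_Ioi)
  have ii := h.intervalIntegrable_mul hk (h.integral_sq_sub_tail hg hg2).1 hs.le
  have lhs : Tendsto (fun x => (∫ x in (0 : ℝ)..s, (g x - G x) * z x ^ 2) -
      ∫ x in (0 : ℝ)..x, (g x - G x) * z x ^ 2) (𝓝[>] 0)
      (𝓝 (∫ x in (0 : ℝ)..s, (g x - G x) * z x ^ 2)) := by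
    have hc := (ii.absolutelyContinuousOnInterval_primitive le_rfl hs.le).1.continuousOn 0
      left_mem_uIcc
    rw [ContinuousWithinAt, intervalIntegral.integral_same, uIcc_of_le hs.le] at hc
    simpa using (hc.mono_left (nhdsWithin_le_of_mem (Icc_mem_nhdsGT hs))).const_sub
      (∫ x in (0 : ℝ)..s, (g x - G x) * z x ^ 2)
  have AG : Tendsto (fun x => A x * G x) (𝓝[>] 0) (𝓝 0) := by
    have b := h.tendsto_nhdsGT_zero.add (h.tendsto_mul_sq_tail hg hg2).1
    rw [add_zero] at b
    refine squeeze_zero_norm' ?_ b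
    filter_upwards [self_mem_nhdsWithin] with x hx
    have hA := h.pos hx
    rw [norm_mul, Real.norm_of_nonneg hA.le, ← mul_one_add]
    refine mul_le_mul_of_nonneg_left ?_ hA.le
    rw [← sq_abs, Real.norm_eq_abs]
    nlinarith [sq_nonneg (|G x| - 1)]
  have rhs : Tendsto (fun x => A x * G x - A s * G s) (𝓝[>] 0) (𝓝 (-(A s * G s))) := by
    simpa using AG.sub_const (A s * G s)
  refine tendsto_nhds_unique lhs (rhs.congr' ?_)
  filter_upwards [Ioc_mem_nhdsGT hs] with ε hε
  rw [intervalIntegral.integral_interval_sub_left ii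
    (h.intervalIntegrable_mul hk (h.integral_sq_sub_tail hg hg2).1 hε.1.le)]
  obtain ⟨hA, dA⟩ := h.absolutelyContinuous hε.1.le hε.2
  obtain ⟨hG, dG⟩ := hac ε s hε.1 hε.2
  have := ((hA.fun_mul hG).fun_neg.integral_eq_sub_of_ae_hasDerivAt
    (p := fun x => (g x - G x) * z x ^ 2) (by
      filter_upwards [dA, dG] with x h1 h2 hx
      have hx0 : 0 < x := by rw [uIcc_of_le hε.2] at hx; exact hε.1.trans_le hx.1
      have := (h.pos hx0).ne'
      refine ((h1 hx).fun_mul (h2 hx)).fun_neg.congr_deriv ?_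
      field_simp
      ring)).2
  rw [this]
  ring

theorem integral_Ioi_sub_average (h : IsHalflineClock z A)
    (hg : AEStronglyMeasurable g (volume.restrict (Ioi 0)))
    (hg2 : IntegrableOn (fun s => g s ^ 2 * z s ^ 2) (Ioi 0)) (hs : 0 < s) :
    ∫ x in Ioi s, (g x - (A x)⁻¹ * ∫ u in (0 : ℝ)..x, g u * z u ^ 2) / A x * z x ^ 2
      = -((A s)⁻¹ * ∫ u in (0 : ℝ)..s, g u * z u ^ 2) := by
  set F : ℝ → ℝ := fun x => ∫ u in (0 : ℝ)..x, g u * z u ^ 2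
  have hac : ∀ a b, 0 < a → a ≤ b → AbsolutelyContinuousOnInterval F a b ∧
      ∀ᵐ x, x ∈ uIcc a b → HasDerivAt F (g x * z x ^ 2) x := fun a b ha hab =>
    IntervalIntegrable.absolutelyContinuousOnInterval_primitive ha.le hab
      (h.intervalIntegrable_mul hg hg2 (ha.le.trans hab))
  have hFc : ContinuousOn F (Ioi 0) := fun x hx => by
    have hx : 0 < x := hx
    have hc := (hac (x / 2) (x + 1) (by linarith) (by linarith)).1.continuousOn
    rw [uIcc_of_le (by linarith)] at hc
    exact (hc.continuousAt (Icc_mem_nhds (by linarith) (by linarith))).continuousWithinAt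
  have hk : AEStronglyMeasurable (fun x => g x - (A x)⁻¹ * F x) (volume.restrict (Ioi 0)) :=
    hg.sub (((h.continuousOn.inv₀ fun x hx => (h.pos hx).ne').mul hFc).aestronglyMeasurable
      measurableSet_Ioi)
  have ii := h.integrableOn_div hk (h.integral_sq_sub_average hg hg2).1 hs
  have lhs := intervalIntegral_tendsto_integral_Ioi s ii tendsto_id
  have AF : Tendsto (fun x => (A x)⁻¹ * F x) atTop (𝓝 0) := by
    have b := (tendsto_inv_atTop_zero.comp h.tendsto_atTop).add
      (h.tendsto_sq_primitive_div hg hg2).2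
    rw [add_zero] at b
    refine squeeze_zero_norm' ?_ b
    filter_upwards [eventually_gt_atTop 0] with x hx
    have hA := inv_pos.2 (h.pos hx)
    rw [norm_mul, Real.norm_of_nonneg hA.le, Function.comp_apply, div_eq_inv_mul, ← mul_one_add]
    refine mul_le_mul_of_nonneg_left ?_ hA.le
    rw [← sq_abs, Real.norm_eq_abs]
    nlinarith [sq_nonneg (|F x| - 1)]
  have rhs : Tendsto (fun x => (A x)⁻¹ * F x - (A s)⁻¹ * F s) atTop
      (𝓝 (-((A s)⁻¹ * F s))) := by
    simpa using AF.sub_const ((A s)⁻¹ * F s)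
  refine tendsto_nhds_unique lhs (rhs.congr' ?_)
  filter_upwards [eventually_ge_atTop s] with T hT
  obtain ⟨hA, dA⟩ := h.absolutelyContinuous_inv hs hT
  obtain ⟨hF, dF⟩ := hac s T hs hT
  exact ((hA.fun_mul hF).integral_eq_sub_of_ae_hasDerivAt
    (p := fun x => (g x - (A x)⁻¹ * F x) / A x * z x ^ 2) (by
      filter_upwards [dA, dF] with x h1 h2 hx
      have hx0 : 0 < x := by rw [uIcc_of_le hT] at hx; exact hs.trans_le hx.1
      have := (h.pos hx0).ne'
      refine ((h1 hx).fun_mul (h2 hx)).congr_deriv ?_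
      field_simp
      ring)).2.symm

end IsHalflineClock

/-- On the half-line, the operators `(β_∞ f)(s) = f(s) − ∫ₛ^∞ (f(u)/A(u)) z(u)² du` and
`(α_∞ f)(s) = f(s) − A(s)⁻¹ ∫₀ˢ f(u) z(u)² du` are mutually inverse isometric
isomorphisms of `L²([0,∞), z(s)² ds)`. -/
theorem alpha_beta_halfline_inverse_isometries
    (z : ℝ → ℝ) (hz : Measurable z)
    (hz2 : ∀ t > (0:ℝ), IntegrableOn (fun s => z s ^ 2) (Set.Ioc 0 t))
    (hzne : ∀ᵐ s ∂(volume.restrict (Set.Ioi (0:ℝ))), z s ≠ 0)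
    (A : ℝ → ℝ) (hA : ∀ t, A t = ∫ s in (0:ℝ)..t, z s ^ 2)
    (hAtop : Filter.Tendsto A Filter.atTop Filter.atTop)
    (f : ℝ → ℝ) (hf : Measurable f)
    (hfL2 : IntegrableOn (fun s => f s ^ 2 * z s ^ 2) (Set.Ioi 0)) :
    ((∫ s in Set.Ioi (0:ℝ),
        (f s - ∫ u in Set.Ioi s, (f u / A u) * z u ^ 2) ^ 2 * z s ^ 2)
      = ∫ s in Set.Ioi (0:ℝ), f s ^ 2 * z s ^ 2)
    ∧ ((∫ s in Set.Ioi (0:ℝ),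
        (f s - (A s)⁻¹ * ∫ u in (0:ℝ)..s, f u * z u ^ 2) ^ 2 * z s ^ 2)
      = ∫ s in Set.Ioi (0:ℝ), f s ^ 2 * z s ^ 2)
    ∧ (∀ᵐ s ∂(volume.restrict (Set.Ioi (0:ℝ))),
        (f s - ∫ v in Set.Ioi s, (f v / A v) * z v ^ 2)
          - (A s)⁻¹ * ∫ u in (0:ℝ)..s,
              (f u - ∫ v in Set.Ioi u, (f v / A v) * z v ^ 2) * z u ^ 2
        = f s)
    ∧ (∀ᵐ s ∂(volume.restrict (Set.Ioi (0:ℝ))),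
        (f s - (A s)⁻¹ * ∫ v in (0:ℝ)..s, f v * z v ^ 2)
          - ∫ u in Set.Ioi s,
              ((f u - (A u)⁻¹ * ∫ v in (0:ℝ)..u, f v * z v ^ 2) / A u) * z u ^ 2
        = f s) := by
  have h : IsHalflineClock z A := ⟨hz, hz2, hzne, hA, hAtop⟩
  have hf' := hf.aestronglyMeasurable (μ := volume.restrict (Ioi (0 : ℝ)))
  refine ⟨(h.integral_sq_sub_tail hf' hfL2).2, (h.integral_sq_sub_average hf' hfL2).2, ?_, ?_⟩
  · filter_upwards [ae_restrict_mem measurableSet_Ioi] with s hs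
    have := (h.pos hs).ne'
    rw [h.integral_sub_tail hf' hfL2 hs]
    field_simp
    ring
  · filter_upwards [ae_restrict_mem measurableSet_Ioi] with s hs
    rw [h.integral_Ioi_sub_average hf' hfL2 hs]
    ring
end
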